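/- Let H be a real inner product space and f : H → ℝ a differentiable function whose gradient is Lipschitz with constant L ≥ 0. Let θ ∈ H, η ≥ 0, G ≥ 0, b ≥ 0, and let g ∈ H satisfy ‖g‖ ≤ G and ‖g − ∇f(θ)‖ ≤ b η. Set θ' = θ − η g. Then f(θ') ≤ f(θ) − (1/2) η ‖∇f(θ)‖² + (L G²/2) η² + (b²/2) η³. -/

import Mathlib

open scoped RealInnerProductSpace

/-- The **descent lemma**: a function with `L`-Lipschitz gradient lies below its quadratic
upper model. -/
theorem le_add_inner_add_of_lipschitz_gradient
    {H : Type*} [NormedAddCommGroup H] [InnerProductSpace ℝ H]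
    {f : H → ℝ} {f' : H → H} {L : ℝ}
    (hgrad : ∀ z : H, HasFDerivAt f ((innerSL ℝ) (f' z)) z)
    (hlip : ∀ z z' : H, ‖f' z - f' z'‖ ≤ L * ‖z - z'‖) (x v : H) :
    f (x + v) ≤ f x + ⟪f' x, v⟫ + L / 2 * ‖v‖ ^ 2 := by
  have hline (t : ℝ) : HasDerivAt (fun t : ℝ => x + t • v) v t := by
    simpa using ((hasDerivAt_id t).smul_const v).const_add x
  have hf (t : ℝ) : HasDerivAt (fun t : ℝ => f (x + t • v)) ⟪f' (x + t • v), v⟫ t := by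
    have := (hgrad (x + t • v)).comp_hasDerivAt t (hline t)
    rwa [innerSL_apply_apply] at this
  have hB (t : ℝ) : HasDerivAt (fun t : ℝ => f x + t * ⟪f' x, v⟫ + L / 2 * ‖v‖ ^ 2 * t ^ 2)
      (⟪f' x, v⟫ + L * t * ‖v‖ ^ 2) t := by
    refine ((((hasDerivAt_id t).mul_const ⟪f' x, v⟫).const_add (f x)).add
      ((hasDerivAt_pow 2 t).const_mul (L / 2 * ‖v‖ ^ 2))).congr_deriv ?_
    push_cast
    ring
  have bound : ∀ t ∈ Set.Ico (0 : ℝ) 1,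
      ⟪f' (x + t • v), v⟫ ≤ ⟪f' x, v⟫ + L * t * ‖v‖ ^ 2 := by
    intro t ht
    have hnorm : ‖f' (x + t • v) - f' x‖ ≤ L * (t * ‖v‖) := by
      simpa [norm_smul, abs_of_nonneg ht.1] using hlip (x + t • v) x
    have hinner := real_inner_le_norm (f' (x + t • v) - f' x) v
    rw [inner_sub_left] at hinner
    linarith [mul_le_mul_of_nonneg_right hnorm (norm_nonneg v)]
  simpa using image_le_of_deriv_right_le_deriv_boundary
    (fun t _ => (hf t).continuousAt.continuousWithinAt)
    (fun t _ => (hf t).hasDerivWithinAt) (by simp)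
    (fun t _ => (hB t).continuousAt.continuousWithinAt)
    (fun t _ => (hB t).hasDerivWithinAt) bound (Set.right_mem_Icc.2 zero_le_one)

/-- **Deterministic one-step descent inequality (Theorem S1, deterministic form).**
If `f : H → ℝ` is differentiable with gradient `f'` (the Fréchet derivative at each point `z`
is `w ↦ ⟪f' z, w⟫`), `f'` is `L`-Lipschitz with `L ≥ 0`, and `g` satisfies `‖g‖ ≤ G` and
`‖g - f' θ‖ ≤ b η` with `η, G, b ≥ 0`, then for `θ' = θ - η g`,
`f θ' ≤ f θ - (1/2) η ‖f' θ‖² + (L G²/2) η² + (b²/2) η³`. -/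
theorem deterministic_one_step_descent
    {H : Type*} [NormedAddCommGroup H] [InnerProductSpace ℝ H]
    (f : H → ℝ) (f' : H → H) (L : ℝ) (hL : 0 ≤ L)
    (hgrad : ∀ z : H, HasFDerivAt f ((innerSL ℝ) (f' z)) z)
    (hlip : ∀ z z' : H, ‖f' z - f' z'‖ ≤ L * ‖z - z'‖)
    (θ : H) (η G b : ℝ) (hη : 0 ≤ η) (hG : 0 ≤ G) (hb : 0 ≤ b)
    (g : H) (hgG : ‖g‖ ≤ G) (hbias : ‖g - f' θ‖ ≤ b * η) :
    f (θ - η • g) ≤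
      f θ - (1 / 2) * η * ‖f' θ‖ ^ 2 + (L * G ^ 2 / 2) * η ^ 2 + (b ^ 2 / 2) * η ^ 3 := by
  have hdesc := le_add_inner_add_of_lipschitz_gradient hgrad hlip θ (-(η • g))
  rw [← sub_eq_add_neg, inner_neg_right, real_inner_smul_right, norm_neg, norm_smul,
    Real.norm_of_nonneg hη, mul_pow] at hdesc
  have hquad : L / 2 * (η ^ 2 * ‖g‖ ^ 2) ≤ L / 2 * (η ^ 2 * G ^ 2) := by gcongr
  have hsq : ‖g - f' θ‖ ^ 2 ≤ (b * η) ^ 2 := by gcongr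
  rw [norm_sub_sq_real, real_inner_comm] at hsq
  have hinner : -⟪f' θ, g⟫ ≤ ((b * η) ^ 2 - ‖f' θ‖ ^ 2) / 2 := by
    linarith [sq_nonneg ‖g‖]
  linarith [mul_le_mul_of_nonneg_left hinner hη]
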